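/- arXiv:2304.03857 — 7 statements merged into one kernel-verified Lean document; each statement's English description precedes it below -/
import Mathlib

section
/- Let n ≥ 0, m ≥ 3 be integers, let D be a digraph on {1,…,m} with arc set A(D) containing no loops, and let k ∈ {1,…,n}. Then t_k^{n,m}(D), the number of arcs of H_n^m(D) along which disc k is moved, satisfies t_k^{n,m}(D) = |A(D)| · m^{n−k} · (m−2)^{k−1}. -/
/-- A state of the Tower of Hanoi with `n` discs and `m` pegs is a function assigning to
each disc (smaller index = smaller disc) the peg on which it lies. `(u, v)` is an arc of the
restricted Hanoi graph `H_n^m(D)` moving disc `k` iff (1) only disc `k` changes peg,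
(2) disc `k` is topmost on its peg in `u`, (3) disc `k` becomes topmost on its peg in `v`,
(4) the move of its peg is an arc of the movement digraph with arc set `A`. -/
def HanoiMove {n m : ℕ} (A : Finset (Fin m × Fin m))
    (u v : Fin n → Fin m) (k : Fin n) : Prop :=
  u k ≠ v k ∧ (∀ d, d ≠ k → u d = v d) ∧
    (∀ d, d < k → u d ≠ u k) ∧ (∀ d, d < k → v d ≠ v k) ∧ (u k, v k) ∈ A

/-- `t_k^{n,m}(D)`: the number of arcs of `H_n^m(D)` along which disc `k` is moved.
Here disc `k : Fin n` corresponds to disc `k + 1` of `{1, …, n}` in the paper. -/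
noncomputable def tArcs {n m : ℕ} (A : Finset (Fin m × Fin m)) (k : Fin n) : ℕ :=
  Nat.card {p : (Fin n → Fin m) × (Fin n → Fin m) // HanoiMove A p.1 p.2 k}

/-- `|A(H_n^m(D))|`: the total number of arcs of the restricted Hanoi graph. -/
noncomputable def totalArcs (n m : ℕ) (A : Finset (Fin m × Fin m)) : ℕ :=
  Nat.card {p : (Fin n → Fin m) × (Fin n → Fin m) // ∃ k, HanoiMove A p.1 p.2 k}

/-- Allowed pegs of disc `d` in the source state of a move of disc `k` along `a`. -/
def pegSet {n m : ℕ} (k : Fin n) (a : Fin m × Fin m) (d : Fin n) : Finset (Fin m) :=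
  if d < k then Finset.univ \ {a.1, a.2} else if d = k then {a.1} else Finset.univ

theorem prod_pegSet {n m : ℕ} (k : Fin n) (a : Fin m × Fin m) (ha : a.1 ≠ a.2) :
    ∏ d, (pegSet k a d).card = m ^ (n - (k.val + 1)) * (m - 2) ^ k.val := by
  have h : ∀ d, (pegSet k a d).card
      = (if d < k then (m - 2) else 1) * (if k < d then m else 1) := by
    intro d
    unfold pegSet
    rcases lt_trichotomy d k with h | h | h
    · rw [if_pos h, if_pos h, if_neg h.asymm, Finset.card_sdiff_of_subset (Finset.subset_univ _),
        Finset.card_pair ha]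
      simp
    · subst h
      simp
    · rw [if_neg h.asymm, if_neg h.ne', if_neg h.asymm, if_pos h]
      simp
  rw [Finset.prod_congr rfl (fun d _ => h d), Finset.prod_mul_distrib, mul_comm]
  have h1 : Finset.univ.filter (fun d => d < k) = Finset.Iio k := by ext; simp
  have h2 : Finset.univ.filter (fun d => k < d) = Finset.Ioi k := by ext; simp
  rw [Finset.prod_ite, Finset.prod_ite, h1, h2]
  simp only [Finset.prod_const, Fin.card_Iio, Fin.card_Ioi, one_pow, mul_one]
  congr 2
  omega

/-- Moves of disc `k` correspond to an arc together with an admissible source state. -/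
def moveEquiv {n m : ℕ} (A : Finset (Fin m × Fin m)) (hA : ∀ p, (p, p) ∉ A) (k : Fin n) :
    {p : (Fin n → Fin m) × (Fin n → Fin m) // HanoiMove A p.1 p.2 k} ≃
      (Σ a : A, {u // u ∈ Fintype.piFinset (pegSet k a.1)}) where
  toFun p := ⟨⟨(p.1.1 k, p.1.2 k), p.2.2.2.2.2⟩, p.1.1, by
    obtain ⟨⟨u, v⟩, h0, h1, h2, h3, h4⟩ := p
    rw [Fintype.mem_piFinset]
    intro d
    unfold pegSet
    split_ifs with h h'
    · have := h1 d h.ne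
      have := h3 d h
      have := h2 d h
      simp_all
    · simp [h']
    · simp⟩
  invFun x := ⟨(x.2.1, Function.update x.2.1 k x.1.1.2), by
    obtain ⟨⟨⟨a, b⟩, hab⟩, u, hu⟩ := x
    rw [Fintype.mem_piFinset] at hu
    have hne : a ≠ b := by rintro rfl; exact hA _ hab
    have hk : u k = a := by simpa [pegSet] using hu k
    have hl : ∀ d, d < k → u d ≠ a ∧ u d ≠ b := by
      intro d hd
      simpa [pegSet, hd] using hu d
    refine ⟨?_, ?_, ?_, ?_, ?_⟩
    · simpa [hk] using hne
    · intro d hd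
      simp [hd]
    · intro d hd
      simpa [hk] using (hl d hd).1
    · intro d hd
      simpa [hd.ne] using (hl d hd).2
    · simpa [hk] using hab⟩
  left_inv p := by
    obtain ⟨⟨u, v⟩, h0, h1, h2, h3, h4⟩ := p
    apply Subtype.ext
    refine Prod.ext rfl ?_
    funext d
    by_cases hd : d = k
    · subst hd; simp
    · simpa [hd] using h1 d hd
  right_inv x := by
    obtain ⟨⟨⟨a, b⟩, hab⟩, u, hu⟩ := x
    have hk : u k = a := by simpa [pegSet] using (Fintype.mem_piFinset.1 hu) k
    subst hk
    have hb : Function.update u k b k = b := by simp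
    refine Sigma.ext (Subtype.ext (Prod.ext rfl hb)) ?_
    dsimp only
    congr! 4
    rw [hb]
    

/-- `t_k^{n,m}(D) = |A(D)| · m^{n-k} · (m-2)^{k-1}`, where `k : Fin n` is disc `k + 1`
of `{1, …, n}` in the paper's indexing. -/
theorem tArcs_eq (n m : ℕ) (hm : 3 ≤ m) (A : Finset (Fin m × Fin m))
    (hA : ∀ p, (p, p) ∉ A) (k : Fin n) :
    tArcs A k = A.card * m ^ (n - (k.val + 1)) * (m - 2) ^ k.val := by
  unfold tArcs
  rw [Nat.card_congr (moveEquiv A hA k), Nat.card_eq_fintype_card, Fintype.card_sigma]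
  have : ∀ a : A, Fintype.card {u // u ∈ Fintype.piFinset (pegSet k a.1)}
      = m ^ (n - (k.val + 1)) * (m - 2) ^ k.val := by
    rintro ⟨⟨a, b⟩, hab⟩
    have hne : a ≠ b := by rintro rfl; exact hA _ hab
    rw [Fintype.card_coe, Fintype.card_piFinset]
    exact prod_pegSet k (a, b) hne
  rw [Finset.sum_congr rfl (fun a _ => this a)]
  simp [mul_assoc]
end

section
/- Let n ≥ 0, m ≥ 3 be integers and k ∈ {1,…,n}. For the directed cycle movement digraph →C_m (arcs (p, p+1) for 1 ≤ p ≤ m−1 together with (m, 1)), the number of arcs of H_n^m(→C_m) that move disc k is t_k^{n,m}(→C_m) = m^{n−k+1} · (m−2)^{k−1}. -/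
/-- The directed cycle digraph `→C_m`: each peg has an arc to the cyclically next peg
(peg `i : Fin m` corresponds to peg `i + 1` of `{1, …, m}` in the paper, so these are the
arcs `(p, p+1)` for `1 ≤ p ≤ m - 1` together with `(m, 1)`). -/
def cycleArcsF (m : ℕ) : Finset (Fin m × Fin m) :=
  Finset.univ.filter fun pq => (pq.1.val + 1) % m = pq.2.val

def hanoiNext {m : ℕ} (p : Fin m) : Fin m :=
  ⟨(p.val + 1) % m, Nat.mod_lt _ (by have := p.isLt; omega)⟩

theorem hanoiNext_ne {m : ℕ} (hm : 3 ≤ m) (p : Fin m) : p ≠ hanoiNext p := by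
  intro h
  have h1 := congrArg Fin.val h
  have hp := p.isLt
  simp only [hanoiNext] at h1
  rcases Nat.lt_or_ge (p.val + 1) m with h2 | h2
  · rw [Nat.mod_eq_of_lt h2] at h1; omega
  · have h3 : p.val + 1 = m := by omega
    rw [h3, Nat.mod_self] at h1; omega

def hanoiBox {n m : ℕ} (k : Fin n) (p : Fin m) (d : Fin n) : Finset (Fin m) :=
  if d = k then {p} else if d < k then {p, hanoiNext p}ᶜ else Finset.univ

theorem mem_hanoiBox {n m : ℕ} (k : Fin n) (p : Fin m) (u : Fin n → Fin m) :
    u ∈ Fintype.piFinset (hanoiBox k p) ↔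
      u k = p ∧ ∀ d, d < k → u d ≠ p ∧ u d ≠ hanoiNext p := by
  rw [Fintype.mem_piFinset]
  constructor
  · intro h
    refine ⟨by simpa [hanoiBox] using h k, fun d hd => ?_⟩
    simpa [hanoiBox, hd, hd.ne] using h d
  · rintro ⟨h1, h2⟩ d
    unfold hanoiBox
    split_ifs with h3 h4
    · subst h3; simp [h1]
    · simpa using h2 d h4
    · simp

theorem card_hanoiBox {n m : ℕ} (hm : 3 ≤ m) (k : Fin n) (p : Fin m) :
    (Fintype.piFinset (hanoiBox k p)).card = (m - 2) ^ k.val * m ^ (n - (k.val + 1)) := by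
  rw [Fintype.card_piFinset]
  have h : ∀ d : Fin n, (hanoiBox k p d).card =
      (if d < k then (m - 2) else 1) * (if k < d then m else 1) := by
    intro d
    unfold hanoiBox
    rcases lt_trichotomy d k with h | h | h
    · rw [if_neg h.ne, if_pos h, if_pos h, if_neg h.not_gt, Finset.card_compl,
        Finset.card_pair (hanoiNext_ne hm p), Fintype.card_fin, mul_one]
    · simp [h]
    · simp [h, h.ne', h.not_gt]
  simp only [h, Finset.prod_mul_distrib, Finset.prod_ite, Finset.prod_const, one_pow, mul_one]
  have h1 : (Finset.univ.filter fun d : Fin n => d < k) = Finset.Iio k := by ext; simp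
  have h2 : (Finset.univ.filter fun d : Fin n => k < d) = Finset.Ioi k := by ext; simp
  rw [h1, h2, Fin.card_Iio, Fin.card_Ioi]
  congr 2
  omega

/-- An arc moving disc `k` is determined by its source state. -/
def hanoiEquiv {n m : ℕ} (hm : 3 ≤ m) (k : Fin n) :
    {p : (Fin n → Fin m) × (Fin n → Fin m) // HanoiMove (cycleArcsF m) p.1 p.2 k} ≃
      (Σ p : Fin m, {u // u ∈ Fintype.piFinset (hanoiBox k p)}) where
  toFun x := ⟨x.1.1 k, x.1.1, by
    obtain ⟨⟨u, v⟩, h1, h2, h3, h4, h5⟩ := x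
    rw [mem_hanoiBox]
    have hv : hanoiNext (u k) = v k := by
      apply Fin.ext
      simpa [cycleArcsF, hanoiNext] using h5
    refine ⟨rfl, fun d hd => ⟨h3 d hd, ?_⟩⟩
    simp only [hv]
    rw [show u d = v d from h2 d hd.ne]
    exact h4 d hd⟩
  invFun y := ⟨(y.2.1, Function.update y.2.1 k (hanoiNext y.1)), by
    obtain ⟨p, u, hu⟩ := y
    rw [mem_hanoiBox] at hu
    obtain ⟨rfl, hu⟩ := hu
    refine ⟨?_, ?_, fun d hd => (hu d hd).1, ?_, ?_⟩
    · simpa using hanoiNext_ne hm (u k)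
    · intro d hd
      simp [hd]
    · intro d hd
      simpa [hd.ne] using (hu d hd).2
    · simp [cycleArcsF, hanoiNext]⟩
  left_inv := by
    rintro ⟨⟨u, v⟩, h1, h2, h3, h4, h5⟩
    have hv : hanoiNext (u k) = v k := by
      apply Fin.ext
      simpa [cycleArcsF, hanoiNext] using h5
    apply Subtype.ext
    refine Prod.ext rfl ?_
    funext d
    by_cases hd : d = k
    · subst hd; simpa using hv
    · simpa [hd] using h2 d hd
  right_inv := by
    rintro ⟨p, u, hu⟩
    have hu' := hu
    rw [mem_hanoiBox] at hu'
    obtain ⟨rfl, -⟩ := hu'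
    rfl

/-- `t_k^{n,m}(→C_m) = m^{n-k+1} · (m-2)^{k-1}`, where `k : Fin n` is disc `k + 1`
of `{1, …, n}` in the paper's indexing. -/
theorem tArcs_cycle (n m : ℕ) (hm : 3 ≤ m) (k : Fin n) :
    tArcs (cycleArcsF m) k = m ^ (n - (k.val + 1) + 1) * (m - 2) ^ k.val := by
  unfold tArcs
  rw [Nat.card_congr (hanoiEquiv hm k), Nat.card_eq_fintype_card, Fintype.card_sigma]
  simp only [Fintype.card_coe, card_hanoiBox hm, Finset.sum_const, Finset.card_univ,
    Fintype.card_fin, smul_eq_mul]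
  ring
end

section
/- Let n ≥ 0, m ≥ 3 be integers and k ∈ {1,…,n}. For the bidirected path movement digraph ↔P_m and the bidirected star movement digraph ↔K_{1,m−1}, the numbers of arcs of the corresponding restricted Hanoi graphs that move disc k coincide and equal t_k^{n,m}(↔P_m) = t_k^{n,m}(↔K_{1,m−1}) = 2(m−1) · m^{n−k} · (m−2)^{k−1}. -/
/-- The bidirected path digraph `↔P_m`: arcs exactly between consecutive pegs. -/
def pathArcsF (m : ℕ) : Finset (Fin m × Fin m) :=
  Finset.univ.filter fun pq => pq.1.val + 1 = pq.2.val ∨ pq.2.val + 1 = pq.1.val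

/-- The bidirected star digraph `↔K_{1,m-1}`: arcs exactly between the center peg
(index `0`, i.e. peg `1` of `{1, …, m}` in the paper) and every other peg. -/
def starArcsF (m : ℕ) : Finset (Fin m × Fin m) :=
  Finset.univ.filter fun pq => pq.1 ≠ pq.2 ∧ (pq.1.val = 0 ∨ pq.2.val = 0)

lemma tArcs_general (n m : ℕ) (A : Finset (Fin m × Fin m)) (hA : ∀ a ∈ A, a.1 ≠ a.2)
    (k : Fin n) :
    tArcs A k = A.card * (m ^ (n - (k.val + 1)) * (m - 2) ^ k.val) := by
  classical
  let S : Fin m × Fin m → Fin n → Finset (Fin m) := fun a d =>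
    if d < k then Finset.univ \ {a.1, a.2} else if d = k then {a.1} else Finset.univ
  have hS : ∀ a u, u ∈ Fintype.piFinset (S a) ↔
      u k = a.1 ∧ ∀ d, d < k → u d ≠ a.1 ∧ u d ≠ a.2 := by
    intro a u
    rw [Fintype.mem_piFinset]
    constructor
    · intro h
      refine ⟨by simpa [S] using h k, fun d hd => ?_⟩
      simpa [S, hd] using h d
    · rintro ⟨h1, h2⟩ d
      by_cases hd : d < k
      · simpa [S, hd] using h2 d hd
      · by_cases hk : d = k
        · subst hk; simp [S, h1]
        · simp [S, hd, hk]
  have hcard : ∀ a ∈ A, (Fintype.piFinset (S a)).card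
      = m ^ (n - (k.val + 1)) * (m - 2) ^ k.val := by
    intro a ha
    rw [Fintype.card_piFinset]
    have h1 : ∀ d, (S a d).card = if d < k then m - 2 else if d = k then 1 else m := by
      intro d
      simp only [S]
      split_ifs
      · rw [Finset.card_sdiff_of_subset (Finset.subset_univ _), Finset.card_pair (hA a ha)]
        simp
      · simp
      · simp
    simp only [h1]
    rw [Finset.prod_ite, Finset.prod_ite]
    simp only [Finset.prod_const, one_pow, one_mul, Finset.filter_filter]
    have e1 : (Finset.univ.filter fun d : Fin n => d < k) = Finset.Iio k := by
      ext; simp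
    have e2 : (Finset.univ.filter fun d : Fin n => ¬ d < k ∧ ¬ d = k) = Finset.Ioi k := by
      ext; simp; omega
    rw [e1, e2, Fin.card_Iio, Fin.card_Ioi, mul_comm]
    congr 2
    omega
  have hsum : (A.sigma fun a => Fintype.piFinset (S a)).card
      = A.card * (m ^ (n - (k.val + 1)) * (m - 2) ^ k.val) := by
    rw [Finset.card_sigma, Finset.sum_congr rfl hcard, Finset.sum_const, smul_eq_mul]
  rw [← hsum, tArcs, Nat.card_eq_fintype_card, Fintype.card_subtype]
  refine Finset.card_nbij'
    (fun p => (⟨(p.1 k, p.2 k), p.1⟩ : Σ _ : Fin m × Fin m, (Fin n → Fin m)))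
    (fun q => (q.2, Function.update q.2 k q.1.2)) ?_ ?_ ?_ ?_
  · rintro ⟨u, v⟩ h
    simp only [Finset.coe_filter, Finset.mem_univ, true_and, Set.mem_ofPred_eq] at h
    obtain ⟨h1, h2, h3, h4, h5⟩ := h
    simp only [Finset.mem_coe, Finset.mem_sigma, hS]
    refine ⟨h5, trivial, fun d hd => ⟨h3 d hd, ?_⟩⟩
    have := h4 d hd
    rwa [← h2 d hd.ne] at this
  · rintro ⟨⟨a, b⟩, u⟩ h
    simp only [Finset.mem_coe, Finset.mem_sigma, hS] at h
    obtain ⟨h1, h2, h3⟩ := h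
    have := hA _ h1
    simp only [Finset.coe_filter, Finset.mem_univ, true_and, Set.mem_ofPred_eq]
    subst h2
    refine ⟨by simpa using this, fun d hd => by simp [hd], fun d hd => (h3 d hd).1,
      fun d hd => ?_, by simpa using h1⟩
    simpa [hd.ne] using (h3 d hd).2
  · rintro ⟨u, v⟩ h
    simp only [Finset.coe_filter, Finset.mem_univ, true_and, Set.mem_ofPred_eq] at h
    obtain ⟨h1, h2, h3, h4, h5⟩ := h
    refine Prod.ext rfl (funext fun d => ?_)
    by_cases hd : d = k
    · subst hd; simp
    · simp [hd, h2 d hd]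
  · rintro ⟨⟨a, b⟩, u⟩ h
    simp only [Finset.mem_coe, Finset.mem_sigma, hS] at h
    obtain ⟨h1, h2, h3⟩ := h
    subst h2
    simp

lemma card_of_param {q : ℕ} (A : Finset (Fin (q + 1) × Fin (q + 1)))
    (f : Fin q → Fin (q + 1)) (hlt : ∀ i : Fin q, f i < i.succ)
    (h : ∀ a, a ∈ A ↔ ∃ i : Fin q, a = (f i, i.succ) ∨ a = (i.succ, f i)) :
    A.card = 2 * q := by
  classical
  have e : A = (Finset.univ.image fun i : Fin q => (f i, i.succ)) ∪
      (Finset.univ.image fun i : Fin q => (i.succ, f i)) := by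
    ext a
    simp only [h, Finset.mem_union, Finset.mem_image, Finset.mem_univ, true_and, exists_or,
      eq_comm]
  rw [e, Finset.card_union_of_disjoint, Finset.card_image_of_injective,
    Finset.card_image_of_injective]
  · simp; omega
  · intro i j hij
    simpa using congrArg Prod.fst hij
  · intro i j hij
    simpa using congrArg Prod.snd hij
  · rw [Finset.disjoint_left]
    intro a h1 h2
    simp only [Finset.mem_image, Finset.mem_univ, true_and] at h1 h2
    obtain ⟨i, rfl⟩ := h1
    obtain ⟨j, hj⟩ := h2
    have hi := hlt i
    have hj' := hlt j
    simp only [Prod.mk.injEq] at hj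
    rw [hj.1, hj.2] at hj'
    exact absurd hi (not_lt.mpr hj'.le)

lemma card_pathArcsF (q : ℕ) : (pathArcsF (q + 1)).card = 2 * q := by
  refine card_of_param _ Fin.castSucc (fun i => Fin.castSucc_lt_succ) ?_
  rintro ⟨a, b⟩
  simp only [pathArcsF, Finset.mem_filter, Finset.mem_univ, true_and, Prod.mk.injEq, Fin.ext_iff,
    Fin.val_castSucc, Fin.val_succ]
  constructor
  · rintro (h | h)
    · exact ⟨⟨a, by omega⟩, Or.inl ⟨rfl, h.symm⟩⟩
    · exact ⟨⟨b, by omega⟩, Or.inr ⟨h.symm, rfl⟩⟩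
  · rintro ⟨i, h | h⟩ <;> omega

lemma card_starArcsF (q : ℕ) : (starArcsF (q + 1)).card = 2 * q := by
  refine card_of_param _ (fun _ => 0) (fun i => Fin.succ_pos i) ?_
  rintro ⟨a, b⟩
  simp only [starArcsF, Finset.mem_filter, Finset.mem_univ, true_and, Prod.mk.injEq, Fin.ext_iff,
    Fin.val_zero, Fin.val_succ, ne_eq]
  constructor
  · rintro ⟨h0, h | h⟩
    · exact ⟨⟨b - 1, by omega⟩, Or.inl ⟨h, by simp only []; omega⟩⟩
    · exact ⟨⟨a - 1, by omega⟩, Or.inr ⟨by simp only []; omega, h⟩⟩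
  · rintro ⟨i, h | h⟩ <;> omega

/-- `t_k^{n,m}(↔P_m) = t_k^{n,m}(↔K_{1,m-1}) = 2(m-1) · m^{n-k} · (m-2)^{k-1}`,
where `k : Fin n` is disc `k + 1` of `{1, …, n}` in the paper's indexing. -/
theorem tArcs_path_star (n m : ℕ) (hm : 3 ≤ m) (k : Fin n) :
    tArcs (pathArcsF m) k = 2 * (m - 1) * m ^ (n - (k.val + 1)) * (m - 2) ^ k.val ∧
      tArcs (starArcsF m) k
        = 2 * (m - 1) * m ^ (n - (k.val + 1)) * (m - 2) ^ k.val := by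
  obtain ⟨q, rfl⟩ : ∃ q, m = q + 1 := ⟨m - 1, by omega⟩
  constructor
  · rw [tArcs_general, card_pathArcsF, Nat.add_sub_cancel, mul_assoc (2 * q)]
    intro a ha he
    simp only [pathArcsF, Finset.mem_filter, he] at ha
    omega
  · rw [tArcs_general, card_starArcsF, Nat.add_sub_cancel, mul_assoc (2 * q)]
    intro a ha
    simp only [starArcsF, Finset.mem_filter] at ha
    exact ha.2.1
end

section
/- Let n ≥ 0, m ≥ 3 be integers and let D be a digraph on {1,…,m} with arc set A(D) containing no loops. Then the number of arcs of the restricted Hanoi graph satisfies 2 · |A(H_n^m(D))| = |A(D)| · (m^n − (m−2)^n), i.e., |A(H_n^m(D))| = (1/2)|A(D)|(m^n − (m−2)^n). -/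
lemma hanoi_sum (a n : ℕ) :
    2 * (∑ k : Fin n, ∏ d : Fin n, (if d < k then a else if d = k then 1 else a + 2)) + a ^ n
      = (a + 2) ^ n := by
  induction n with
  | zero => simp
  | succ n ih =>
    rw [Fin.sum_univ_succ]
    simp only [Fin.prod_univ_succ, Fin.succ_lt_succ_iff, Fin.succ_inj, Fin.succ_pos, if_true,
      Fin.not_lt_zero, if_false, Fin.succ_ne_zero, lt_irrefl, Finset.prod_const,
      Finset.card_univ, Fintype.card_fin, ← Finset.mul_sum]
    rw [pow_succ (a + 2), ← ih] 
    ring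

/-- States from which disc `k` can be moved along the arc `e`. -/
def hanoiStates {n m : ℕ} (k : Fin n) (e : Fin m × Fin m) : Finset (Fin n → Fin m) :=
  Fintype.piFinset fun d => if d < k then {e.1, e.2}ᶜ else if d = k then {e.1} else Finset.univ

lemma mem_hanoiStates {n m : ℕ} (k : Fin n) (e : Fin m × Fin m) (u : Fin n → Fin m) :
    u ∈ hanoiStates k e ↔ u k = e.1 ∧ ∀ d, d < k → u d ≠ e.1 ∧ u d ≠ e.2 := by
  simp only [hanoiStates, Fintype.mem_piFinset]
  constructor
  · intro h
    refine ⟨by simpa using h k, fun d hd => ?_⟩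
    simpa [hd] using h d
  · rintro ⟨h1, h2⟩ d
    split_ifs with h3 h4
    · simpa using h2 d h3
    · simp [h4, h1]
    · simp

lemma card_hanoiStates {n m : ℕ} (k : Fin n) (e : Fin m × Fin m) (he : e.1 ≠ e.2) :
    (hanoiStates k e).card
      = ∏ d : Fin n, (if d < k then m - 2 else if d = k then 1 else m) := by
  rw [hanoiStates, Fintype.card_piFinset]
  refine Finset.prod_congr rfl fun d _ => ?_
  split_ifs
  · rw [Finset.card_compl, Finset.card_pair he, Fintype.card_fin]
  · simp
  · simp

open Classical in
lemma totalArcs_eq (n m : ℕ) (A : Finset (Fin m × Fin m)) (hA : ∀ p, (p, p) ∉ A) :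
    totalArcs n m A
      = ∑ k : Fin n, ∑ e ∈ A, (hanoiStates k e).card := by
  rw [totalArcs, Nat.card_eq_fintype_card, Fintype.card_subtype]
  rw [← Finset.sum_product', ← Finset.card_sigma]
  symm
  refine Finset.card_bij (fun x _ => (x.2, Function.update x.2 x.1.1 x.1.2.2)) ?_ ?_ ?_
  · rintro ⟨⟨k, i, j⟩, u⟩ hx
    simp only [Finset.mem_sigma, Finset.mem_product, Finset.mem_univ, true_and,
      mem_hanoiStates] at hx
    obtain ⟨he, hk, hd⟩ := hx
    have hij : i ≠ j := fun h => hA i (by rw [← h] at he; exact he)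
    simp only [Finset.mem_filter, Finset.mem_univ, true_and]
    refine ⟨k, ?_, ?_, ?_, ?_, ?_⟩
    · simpa [hk] using hij
    · intro d hdk
      simp [hdk]
    · intro d hdk
      rw [hk]; exact (hd d hdk).1
    · intro d hdk
      simpa [hdk.ne] using (hd d hdk).2
    · simpa [hk] using he
  · rintro ⟨⟨k, i, j⟩, u⟩ hx ⟨⟨k', i', j'⟩, u'⟩ hx' h
    simp only [Finset.mem_sigma, Finset.mem_product, Finset.mem_univ, true_and,
      mem_hanoiStates] at hx hx'
    obtain ⟨he, hk, -⟩ := hx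
    obtain ⟨he', hk', -⟩ := hx'
    have hij : i ≠ j := fun h => hA i (by rw [← h] at he; exact he)
    simp only [Prod.mk.injEq] at h
    obtain ⟨rfl, h⟩ := h
    have h1 := congrFun h k
    have hkk : k = k' := by
      by_contra hne
      simp [hne] at h1
      exact hij (hk.symm.trans h1.symm)
    subst hkk
    simp at h1
    subst h1 hk hk'
    rfl
  · rintro ⟨u, v⟩ h
    simp only [Finset.mem_filter, Finset.mem_univ, true_and] at h
    obtain ⟨k, h1, h2, h3, h4, h5⟩ := h
    refine ⟨⟨(k, u k, v k), u⟩, ?_, ?_⟩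
    · simp only [Finset.mem_sigma, Finset.mem_product, Finset.mem_univ, true_and,
        mem_hanoiStates]
      refine ⟨h5, fun d hd => ⟨h3 d hd, ?_⟩⟩
      rw [h2 d hd.ne]; exact h4 d hd
    · simp only [Prod.mk.injEq, true_and]
      funext d
      by_cases hd : d = k
      · subst hd; simp
      · simp [hd, h2 d hd]

/-- `2 · |A(H_n^m(D))| = |A(D)| · (m^n - (m-2)^n)`, i.e.
`|A(H_n^m(D))| = (1/2) · |A(D)| · (m^n - (m-2)^n)`. -/
theorem totalArcs_formula (n m : ℕ) (hm : 3 ≤ m) (A : Finset (Fin m × Fin m))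
    (hA : ∀ p, (p, p) ∉ A) :
    2 * totalArcs n m A = A.card * (m ^ n - (m - 2) ^ n) := by
  have key : totalArcs n m A = A.card *
      ∑ k : Fin n, ∏ d : Fin n, (if d < k then m - 2 else if d = k then 1 else m) := by
    rw [totalArcs_eq n m A hA, Finset.mul_sum]
    refine Finset.sum_congr rfl fun k _ => ?_
    rw [Finset.sum_congr rfl fun e he => card_hanoiStates k e ?_]
    · simp
    · intro h
      apply hA e.1
      have : (e.1, e.1) = e := Prod.ext rfl h
      rw [this]; exact he
  have hs := hanoi_sum (m - 2) n
  rw [Nat.sub_add_cancel (by omega : 2 ≤ m)] at hs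
  rw [key, ← hs, Nat.add_sub_cancel]
  ring
end

section
/- Let n ≥ 0 and m ≥ 3 be integers. For the complete bidirected movement digraph ↔K_m, the number of arcs of the restricted Hanoi graph satisfies 2 · |A(H_n^m(↔K_m))| = m(m−1)(m^n − (m−2)^n), i.e., |A(H_n^m(↔K_m))| = (1/2)m(m−1)(m^n − (m−2)^n). -/
/-- The complete bidirected digraph `↔K_m`: all ordered pairs of distinct pegs are arcs. -/
def completeArcsF (m : ℕ) : Finset (Fin m × Fin m) :=
  Finset.univ.filter fun pq => pq.1 ≠ pq.2

theorem arc_snoc_iff {n m : ℕ} (u v : Fin n → Fin m) (p q : Fin m) :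
    (∃ k, HanoiMove (completeArcsF m) (Fin.snoc (α := fun _ => Fin m) u p)
      (Fin.snoc (α := fun _ => Fin m) v q) k) ↔
    (if p = q then (∃ k, HanoiMove (completeArcsF m) u v k)
      else (u = v ∧ ∀ d, u d ≠ p ∧ u d ≠ q)) := by
  unfold HanoiMove completeArcsF
  rw [Fin.exists_fin_succ']
  simp only [Fin.forall_fin_succ', Fin.snoc_castSucc, Fin.snoc_last, Finset.mem_filter,
    Finset.mem_univ, true_and, ne_eq, Fin.castSucc_inj, Fin.castSucc_lt_castSucc_iff,
    Fin.castSucc_lt_last, lt_irrefl, not_true_eq_false, false_imp_iff, and_true,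
    (Fin.castSucc_lt_last _).ne', (Fin.castSucc_lt_last _).ne, (Fin.castSucc_lt_last _).not_gt,
    not_false_eq_true, true_imp_iff]
  by_cases h : p = q
  · simp [h]
  · simp only [h, and_false, false_and, exists_false, false_or, if_false, not_false_eq_true,
      and_true, true_and, funext_iff]
    constructor
    · rintro ⟨h1, h2, h3⟩
      exact ⟨h1, fun d => ⟨h2 d, by rw [h1 d]; exact h3 d⟩⟩
    · rintro ⟨h1, h2⟩
      exact ⟨h1, fun d => (h2 d).1, fun d => by rw [← h1 d]; exact (h2 d).2⟩

open Classical in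
theorem totalArcs_eq_sum (n m : ℕ) : totalArcs n m (completeArcsF m) =
    ∑ u : Fin n → Fin m, ∑ v : Fin n → Fin m,
      if ∃ k, HanoiMove (completeArcsF m) u v k then 1 else 0 := by
  unfold totalArcs
  rw [Nat.card_eq_fintype_card, Fintype.card_subtype, Finset.card_filter, Fintype.sum_prod_type]

open Classical in
theorem card_avoid (n m : ℕ) (p q : Fin m) (h : p ≠ q) :
    (∑ u : Fin n → Fin m, ∑ v : Fin n → Fin m,
      if (u = v ∧ ∀ d, u d ≠ p ∧ u d ≠ q) then 1 else 0) = (m - 2) ^ n := by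
  have : ∀ u : Fin n → Fin m, (∑ v : Fin n → Fin m,
      if (u = v ∧ ∀ d, u d ≠ p ∧ u d ≠ q) then 1 else 0) =
      if (∀ d, u d ≠ p ∧ u d ≠ q) then 1 else 0 := by
    intro u
    simp only [ite_and, Finset.sum_ite_eq, Finset.mem_univ, if_true]
  simp only [this]
  rw [← Finset.card_filter]
  have h2 : (Finset.univ.filter fun u : Fin n → Fin m => ∀ d, u d ≠ p ∧ u d ≠ q) =
      Fintype.piFinset fun _ => ({p, q} : Finset (Fin m))ᶜ := by
    ext u; simp [Fintype.mem_piFinset]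
  rw [h2, Fintype.card_piFinset]
  rw [Finset.prod_const, Finset.card_compl, Finset.card_pair h]
  simp

theorem totalArcs_succ (n m : ℕ) : totalArcs (n + 1) m (completeArcsF m) =
    m * totalArcs n m (completeArcsF m) + m * (m - 1) * (m - 2) ^ n := by
  classical
  rw [totalArcs_eq_sum (n + 1)]
  rw [← (Fin.snocEquiv (fun _ : Fin (n + 1) => Fin m)).sum_comp]
  simp only [← (Fin.snocEquiv (fun _ : Fin (n + 1) => Fin m)).sum_comp
    (fun v => if ∃ k, HanoiMove (completeArcsF m) _ v k then 1 else 0)]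
  simp only [Fin.snocEquiv, Equiv.coe_fn_mk, Fintype.sum_prod_type, arc_snoc_iff]
  have key : ∀ p q : Fin m, (∑ u : Fin n → Fin m, ∑ v : Fin n → Fin m,
      if (if p = q then (∃ k, HanoiMove (completeArcsF m) u v k)
      else (u = v ∧ ∀ d, u d ≠ p ∧ u d ≠ q)) then 1 else 0) =
      if p = q then totalArcs n m (completeArcsF m) else (m - 2) ^ n := by
    intro p q
    by_cases h : p = q
    · simp only [h, if_true]
      rw [totalArcs_eq_sum]
    · simp only [h, if_false]
      exact card_avoid n m p q h
  have row : ∀ p : Fin m, (∑ u : Fin n → Fin m, ∑ q : Fin m, ∑ v : Fin n → Fin m,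
      if (if p = q then (∃ k, HanoiMove (completeArcsF m) u v k)
      else (u = v ∧ ∀ d, u d ≠ p ∧ u d ≠ q)) then 1 else 0) =
      totalArcs n m (completeArcsF m) + (m - 1) * (m - 2) ^ n := by
    intro p
    rw [Finset.sum_comm]
    simp only [key]
    rw [← Finset.add_sum_erase _ _ (Finset.mem_univ p), if_pos rfl]
    congr 1
    rw [Finset.sum_congr rfl (g := fun _ => (m - 2) ^ n)]
    · simp
    · intro q hq
      rw [if_neg (Finset.ne_of_mem_erase hq).symm]
  simp only [row]
  simp
  ring

/-- `2 · |A(H_n^m(↔K_m))| = m(m-1)(m^n - (m-2)^n)`, i.e.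
`|A(H_n^m(↔K_m))| = (1/2) · m(m-1)(m^n - (m-2)^n)`. -/
theorem totalArcs_complete (n m : ℕ) (hm : 3 ≤ m) :
    2 * totalArcs n m (completeArcsF m) = m * (m - 1) * (m ^ n - (m - 2) ^ n) := by
  induction n with
  | zero => simp [totalArcs]
  | succ n ih =>
    rw [totalArcs_succ]
    obtain ⟨c, rfl⟩ : ∃ c, m = c + 2 := ⟨m - 2, by omega⟩
    have e1 : c + 2 - 2 = c := by omega
    have e2 : c + 2 - 1 = c + 1 := by omega
    rw [e1, e2] at ih ⊢
    obtain ⟨d, hd⟩ := Nat.exists_eq_add_of_le (Nat.pow_le_pow_left (show c ≤ c + 2 by omega) n)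
    have e3 : (c + 2) ^ (n + 1) - c ^ (n + 1) = (c + 2) * d + 2 * c ^ n := by
      rw [pow_succ (c + 2), hd, pow_succ]
      apply Nat.sub_eq_of_eq_add
      ring
    rw [hd, Nat.add_sub_cancel_left] at ih
    rw [e3]
    linear_combination (c + 2) * ih
end

section
/- Let n ≥ 0 and m ≥ 3 be integers. For the directed cycle movement digraph →C_m, the number of arcs of the restricted Hanoi graph satisfies 2 · |A(H_n^m(→C_m))| = m(m^n − (m−2)^n), i.e., |A(H_n^m(→C_m))| = (1/2)m(m^n − (m−2)^n). -/
open Classical in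
/-- States in which the smallest disc on `{p, q}` exists and lies on `p`. -/
noncomputable def hanoiF (n : ℕ) {m : ℕ} (p q : Fin m) : Finset (Fin n → Fin m) :=
  Finset.univ.filter fun u => ∃ k, u k = p ∧ ∀ d, d < k → u d ≠ p ∧ u d ≠ q

theorem mem_hanoiF {n m : ℕ} {p q : Fin m} {u : Fin n → Fin m} :
    u ∈ hanoiF n p q ↔ ∃ k, u k = p ∧ ∀ d, d < k → u d ≠ p ∧ u d ≠ q := by
  simp [hanoiF]

theorem hanoiF_swap_le (n : ℕ) {m : ℕ} (p q : Fin m) :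
    (hanoiF n p q).card ≤ (hanoiF n q p).card := by
  refine Finset.card_le_card_of_injOn (fun u d => Equiv.swap p q (u d)) ?_ ?_
  · intro u hu
    obtain ⟨k, hk, h⟩ := mem_hanoiF.1 hu
    refine mem_hanoiF.2 ⟨k, by simp [hk], fun d hd => ?_⟩
    have := h d hd
    beta_reduce
    rw [Equiv.swap_apply_of_ne_of_ne this.1 this.2]
    exact ⟨this.2, this.1⟩
  · intro u _ v _ h
    funext d
    exact (Equiv.swap p q).injective (congrFun h d)

theorem two_mul_hanoiF (n : ℕ) {m : ℕ} (p q : Fin m) (hpq : p ≠ q) :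
    2 * (hanoiF n p q).card = m ^ n - (m - 2) ^ n := by
  classical
  have hsw := le_antisymm (hanoiF_swap_le n p q) (hanoiF_swap_le n q p)
  have hdis : Disjoint (hanoiF n p q) (hanoiF n q p) := by
    rw [Finset.disjoint_left]
    intro u h1 h2
    obtain ⟨k, hk, h⟩ := mem_hanoiF.1 h1
    obtain ⟨l, hl, h'⟩ := mem_hanoiF.1 h2
    rcases lt_trichotomy k l with c | c | c
    · exact (h' k c).2 hk
    · subst c
      exact hpq (hk.symm.trans hl)
    · exact (h l c).2 hl
  have hcompl : (hanoiF n p q ∪ hanoiF n q p)ᶜ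
      = Fintype.piFinset (fun _ : Fin n => ({p, q} : Finset (Fin m))ᶜ) := by
    ext u
    simp only [Finset.mem_compl, Finset.mem_union, Fintype.mem_piFinset, Finset.mem_insert,
      Finset.mem_singleton]
    constructor
    · intro h d
      induction d using WellFoundedLT.induction with
      | ind d ih =>
        intro hd
        apply h
        rcases hd with hd | hd
        · exact Or.inl (mem_hanoiF.2 ⟨d, hd, fun e he => not_or.1 (ih e he)⟩)
        · exact Or.inr (mem_hanoiF.2 ⟨d, hd, fun e he => (not_or.1 (ih e he)).symm⟩)
    · rintro h (h1 | h1)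
      · obtain ⟨k, hk, _⟩ := mem_hanoiF.1 h1
        exact h k (Or.inl hk)
      · obtain ⟨k, hk, _⟩ := mem_hanoiF.1 h1
        exact h k (Or.inr hk)
  have h1 := Finset.card_add_card_compl (hanoiF n p q ∪ hanoiF n q p)
  rw [hcompl, Finset.card_union_of_disjoint hdis, Fintype.card_piFinset_const,
    Finset.card_compl, Finset.card_pair hpq, ← hsw] at h1
  simp at h1
  omega

theorem totalArcs_eq_sum_s13 (n m : ℕ) (s : Fin m → Fin m) (hs : ∀ p, p ≠ s p)
    (A : Finset (Fin m × Fin m)) (hA : ∀ p q, (p, q) ∈ A ↔ s p = q) :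
    totalArcs n m A = ∑ p, (hanoiF n p (s p)).card := by
  classical
  have hc : ∀ x : (Σ p : Fin m, {u // u ∈ hanoiF n p (s p)}),
      ∃ k, x.2.1 k = x.1 ∧ ∀ d, d < k → x.2.1 d ≠ x.1 ∧ x.2.1 d ≠ s x.1 :=
    fun x => mem_hanoiF.1 x.2.2
  choose K hK1 hK2 using hc
  have key : Nat.card (Σ p : Fin m, {u // u ∈ hanoiF n p (s p)}) = totalArcs n m A := by
    refine Nat.card_eq_of_bijective
      (fun x => ⟨(x.2.1, Function.update x.2.1 (K x) (s x.1)), K x, ?_⟩) ⟨?_, ?_⟩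
    · refine ⟨?_, ?_, ?_, ?_, ?_⟩
      · simpa [hK1] using hs x.1
      · intro d hd
        simp [hd]
      · intro d hd
        simpa [hK1] using (hK2 x d hd).1
      · intro d hd
        simpa [hd.ne] using (hK2 x d hd).2
      · simp [hK1, hA]
    · intro x y h
      have h0 := congrArg Subtype.val h
      have hu : x.2.1 = y.2.1 := congrArg Prod.fst h0
      have hv : Function.update x.2.1 (K x) (s x.1) = Function.update y.2.1 (K y) (s y.1) :=
        congrArg Prod.snd h0
      have hk : K x = K y := by
        by_contra hne
        have := congrFun hv (K x)
        rw [Function.update_self, Function.update_of_ne hne, ← hu, hK1] at this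
        exact hs _ this.symm
      have hp : x.1 = y.1 := by rw [← hK1 x, ← hK1 y, hu, hk]
      clear h h0 hv hk
      obtain ⟨p, u, hu1⟩ := x
      obtain ⟨q, v, hv1⟩ := y
      simp only at hu hp
      subst hp
      subst hu
      rfl
    · rintro ⟨⟨u, v⟩, k, h1, h2, h3, h4, h5⟩
      simp only at h1 h2 h3 h4 h5
      have hv : s (u k) = v k := (hA _ _).1 h5
      have hgood : ∀ d, d < k → u d ≠ u k ∧ u d ≠ s (u k) := fun d hd =>
        ⟨h3 d hd, by rw [hv, h2 d hd.ne]; exact h4 d hd⟩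
      refine ⟨⟨u k, u, mem_hanoiF.2 ⟨k, rfl, hgood⟩⟩, ?_⟩
      generalize hx : (⟨u k, u, mem_hanoiF.2 ⟨k, rfl, hgood⟩⟩ :
        Σ p : Fin m, {u // u ∈ hanoiF n p (s p)}) = x
      have e1 : x.1 = u k := by rw [← hx]
      have e2 : x.2.1 = u := by rw [← hx]
      have a1 := hK1 x
      have a2 := hK2 x
      rw [e2, e1] at a1
      simp only [e2, e1] at a2
      have hk : K x = k := by
        rcases lt_trichotomy (K x) k with c | c | c
        · exact absurd a1 (hgood _ c).1
        · exact c
        · exact absurd rfl (a2 _ c).1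
      apply Subtype.ext
      simp only [e1, e2, hk, hv]
      refine Prod.ext rfl ?_
      funext d
      by_cases hd : d = k
      · subst hd
        simp
      · simp [hd, h2 d hd]
  rw [← key]
  simp

/-- `2 · |A(H_n^m(→C_m))| = m(m^n - (m-2)^n)`, i.e.
`|A(H_n^m(→C_m))| = (1/2) · m(m^n - (m-2)^n)`. -/
theorem totalArcs_cycle (n m : ℕ) (hm : 3 ≤ m) :
    2 * totalArcs n m (cycleArcsF m) = m * (m ^ n - (m - 2) ^ n) := by
  have h0 : 0 < m := by omega
  have hs : ∀ p : Fin m, p ≠ ⟨(p.val + 1) % m, Nat.mod_lt _ h0⟩ := by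
    intro p h
    have h' := congrArg Fin.val h
    have hp := p.isLt
    simp only at h'
    rcases Nat.lt_or_ge (p.val + 1) m with c | c
    · rw [Nat.mod_eq_of_lt c] at h'
      omega
    · have e : p.val + 1 = m := by omega
      rw [e, Nat.mod_self] at h'
      omega
  rw [totalArcs_eq_sum_s13 n m (fun p => ⟨(p.val + 1) % m, Nat.mod_lt _ h0⟩) hs _
    (by intro p q; simp [cycleArcsF, Fin.ext_iff]),
    Finset.mul_sum, Finset.sum_congr rfl (fun p _ => two_mul_hanoiF n _ _ (hs p))]
  simp
end

section
/- Let n ≥ 0 and m ≥ 3 be integers. For the bidirected path movement digraph ↔P_m and the bidirected star movement digraph ↔K_{1,m−1}, the numbers of arcs of the corresponding restricted Hanoi graphs coincide and equal |A(H_n^m(↔P_m))| = |A(H_n^m(↔K_{1,m−1}))| = (m−1)(m^n − (m−2)^n). -/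
theorem hanoi_card_hit (n m : ℕ) (a b : Fin m) (hab : a ≠ b) :
    Nat.card {u : Fin n → Fin m // ∃ k, u k = a ∨ u k = b} = m ^ n - (m - 2) ^ n := by
  classical
  have h1 : Fintype.card {u : Fin n → Fin m // ¬ ∃ k, u k = a ∨ u k = b} = (m - 2) ^ n := by
    have e : {u : Fin n → Fin m // ¬ ∃ k, u k = a ∨ u k = b} ≃
        (Fin n → {x : Fin m // ¬ (x = a ∨ x = b)}) :=
      { toFun := fun u k => ⟨u.1 k, fun h => u.2 ⟨k, h⟩⟩
        invFun := fun w => ⟨fun k => (w k).1, fun ⟨k, h⟩ => (w k).2 h⟩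
        left_inv := fun u => rfl
        right_inv := fun w => rfl }
    rw [Fintype.card_congr e, Fintype.card_fun, Fintype.card_fin, Fintype.card_subtype_compl,
      Fintype.card_fin]
    congr 2
    rw [Fintype.card_subtype]
    have : (Finset.univ.filter fun x : Fin m => x = a ∨ x = b) = {a, b} := by
      ext x; simp
    rw [this, Finset.card_pair hab]
  have h2 := Fintype.card_subtype_compl (fun u : Fin n → Fin m => ∃ k, u k = a ∨ u k = b)
  have h3 := Fintype.card_subtype_le (fun u : Fin n → Fin m => ∃ k, u k = a ∨ u k = b)
  have h4 : Fintype.card (Fin n → Fin m) = m ^ n := by simp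
  rw [Nat.card_eq_fintype_card]
  rw [h4] at h2 h3
  rw [h1] at h2
  omega

theorem hanoi_total (n m r : ℕ) (A : Finset (Fin m × Fin m)) (a b : Fin r → Fin m)
    (hab : ∀ i, a i ≠ b i)
    (hA : ∀ x y, (x, y) ∈ A ↔ ∃ i, (x = a i ∧ y = b i) ∨ (x = b i ∧ y = a i))
    (hu : ∀ i j, (a i = a j ∧ b i = b j) ∨ (a i = b j ∧ b i = a j) → i = j) :
    totalArcs n m A = r * (m ^ n - (m - 2) ^ n) := by
  classical
  have hk : ∀ x : (Σ i : Fin r, {u : Fin n → Fin m // ∃ k, u k = a i ∨ u k = b i}),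
      ∃ k, (x.2.1 k = a x.1 ∨ x.2.1 k = b x.1) ∧
        ∀ d, d < k → ¬ (x.2.1 d = a x.1 ∨ x.2.1 d = b x.1) := by
    rintro ⟨i, u, h⟩
    obtain ⟨k, hk, hmin⟩ := WellFounded.has_min (wellFounded_lt (α := Fin n))
      {k | u k = a i ∨ u k = b i} h
    exact ⟨k, hk, fun d hd h' => hmin d h' hd⟩
  choose kk hhit hmin using hk
  let other : Fin r → Fin m → Fin m := fun i x => if x = a i then b i else a i
  have hoa : ∀ i, other i (a i) = b i := fun i => by simp [other]
  have hob : ∀ i, other i (b i) = a i := fun i => by simp [other, (hab i).symm]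
  have hmove : ∀ x : (Σ i : Fin r, {u : Fin n → Fin m // ∃ k, u k = a i ∨ u k = b i}),
      HanoiMove A x.2.1 (Function.update x.2.1 (kk x) (other x.1 (x.2.1 (kk x)))) (kk x) := by
    intro x
    have h1 := hhit x
    have h2 := hmin x
    have h3 := hab x.1
    have h4 := hoa x.1
    have h5 := hob x.1
    refine ⟨?_, ?_, ?_, ?_, ?_⟩
    · rw [Function.update_self]
      rcases h1 with h | h <;> rw [h] <;> simp only [h4, h5] <;> grind
    · intro d hd
      rw [Function.update_of_ne hd]
    · intro d hd; have := h2 d hd; grind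
    · intro d hd
      rw [Function.update_self, Function.update_of_ne hd.ne]
      have := h2 d hd; grind
    · rw [Function.update_self, hA]
      exact ⟨x.1, by grind⟩
  let f : (Σ i : Fin r, {u : Fin n → Fin m // ∃ k, u k = a i ∨ u k = b i}) →
      {p : (Fin n → Fin m) × (Fin n → Fin m) // ∃ k, HanoiMove A p.1 p.2 k} :=
    fun x => ⟨(x.2.1, Function.update x.2.1 (kk x) (other x.1 (x.2.1 (kk x)))), kk x, hmove x⟩
  have hf : Function.Bijective f := by
    constructor
    · intro x y hxy
      have e1 : x.2.1 = y.2.1 := congrArg (fun z => z.1.1) hxy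
      have e2 : Function.update x.2.1 (kk x) (other x.1 (x.2.1 (kk x))) =
        Function.update y.2.1 (kk y) (other y.1 (y.2.1 (kk y))) :=
          congrArg (fun z => z.1.2) hxy
      have hkk : kk x = kk y := by
        by_contra hne
        apply (hmove x).1
        rw [e2, Function.update_of_ne hne, e1]
      have e3 := congrFun e2 (kk x)
      rw [← hkk, Function.update_self, Function.update_self, ← e1] at e3
      have hx := hhit x
      have hy := hhit y
      rw [← hkk, ← e1] at hy
      have hi : x.1 = y.1 := by
        apply hu
        have := hoa x.1
        have := hob x.1
        have := hoa y.1
        have := hob y.1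
        grind
      obtain ⟨i, u, h⟩ := x
      obtain ⟨j, w, h'⟩ := y
      simp only at hi e1
      subst hi
      subst e1
      rfl
    · rintro ⟨⟨u, v⟩, k, h1, h2, h3, h4, h5⟩
      simp only at h1 h2 h3 h4 h5
      obtain ⟨i, hi⟩ := (hA _ _).1 h5
      have hex : u k = a i ∨ u k = b i := by grind
      refine ⟨⟨i, u, k, hex⟩, ?_⟩
      have hh := hhit ⟨i, u, k, hex⟩
      have hm := hmin ⟨i, u, k, hex⟩
      have hkk : kk ⟨i, u, k, hex⟩ = k := by
        rcases lt_trichotomy (kk ⟨i, u, k, hex⟩) k with h | h | h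
        · have := h2 _ h.ne
          have := h3 _ h
          have := h4 _ h
          simp only at hh
          grind
        · exact h
        · exact absurd hex (hm k h)
      apply Subtype.ext
      refine Prod.ext rfl ?_
      funext d
      simp only [f]
      rw [hkk]
      by_cases hd : d = k
      · subst hd
        rw [Function.update_self]
        have := hoa i
        have := hob i
        grind
      · rw [Function.update_of_ne hd, h2 d hd]
  unfold totalArcs
  rw [← Nat.card_congr (Equiv.ofBijective f hf), Nat.card_sigma]
  rw [Finset.sum_congr rfl fun i _ => hanoi_card_hit n m _ _ (hab i)]
  simp

theorem totalArcs_path_star (n m : ℕ) (hm : 3 ≤ m) :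
    totalArcs n m (pathArcsF m) = (m - 1) * (m ^ n - (m - 2) ^ n) ∧
      totalArcs n m (starArcsF m) = (m - 1) * (m ^ n - (m - 2) ^ n) := by
  constructor
  · apply hanoi_total n m (m - 1) _ (fun i => ⟨i.1, by omega⟩) (fun i => ⟨i.1 + 1, by omega⟩)
    · intro i; simp [Fin.ext_iff]
    · intro x y
      simp only [pathArcsF, Finset.mem_filter, Finset.mem_univ, true_and, Fin.ext_iff]
      constructor
      · rintro (h | h)
        · exact ⟨⟨x.1, by omega⟩, Or.inl ⟨rfl, h.symm⟩⟩
        · exact ⟨⟨y.1, by omega⟩, Or.inr ⟨h.symm, rfl⟩⟩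
      · rintro ⟨i, h⟩; omega
    · intro i j
      simp only [Fin.ext_iff]; omega
  · apply hanoi_total n m (m - 1) _ (fun i => ⟨0, by omega⟩) (fun i => ⟨i.1 + 1, by omega⟩)
    · intro i; simp [Fin.ext_iff]
    · intro x y
      simp only [starArcsF, Finset.mem_filter, Finset.mem_univ, true_and, Fin.ext_iff, ne_eq]
      constructor
      · rintro ⟨h, h' | h'⟩
        · exact ⟨⟨y.1 - 1, by omega⟩, by simp only; omega⟩
        · exact ⟨⟨x.1 - 1, by omega⟩, by simp only; omega⟩
      · rintro ⟨i, h⟩; omega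
    · intro i j
      simp only [Fin.ext_iff]; omega
end
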